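/- arXiv:2407.17749 — 4 statements merged into one kernel-verified Lean document; each statement's English description precedes it below -/
import Mathlib

section
/- Let n ≥ 2 and let A₁, A₂, B be as in the multiplex construction (B is the combined-layer matrix built from the row-stochastic, symmetric-support layer matrices A₁, A₂, with B irreducible and every strongly connected component of each layer containing an odd closed walk). Then the product matrix C' = B · A₁ is irreducible, i.e., for all indices i, j there exists m ≥ 1 such that ((B·A₁)^m)_{ij} > 0. -/
open Matrix

section Support

variable {ι : Type*} [Fintype ι]

theorem Matrix.exists_pos_of_mul_apply_pos {M N : Matrix ι ι ℝ} (hM : ∀ i j, 0 ≤ M i j)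
    (hN : ∀ i j, 0 ≤ N i j) {i j : ι} (h : 0 < (M * N) i j) : ∃ k, 0 < M i k ∧ 0 < N k j := by
  rw [mul_apply] at h
  obtain ⟨k, -, hk⟩ := Finset.exists_lt_of_sum_lt (f := fun _ : ι => (0 : ℝ)) (by simpa using h)
  exact ⟨k, pos_of_mul_pos_left hk (hN k j), pos_of_mul_pos_right hk (hM i k)⟩

theorem Matrix.mul_apply_pos_of_pos {M N : Matrix ι ι ℝ} (hM : ∀ i j, 0 ≤ M i j)
    (hN : ∀ i j, 0 ≤ N i j) {i k j : ι} (h₁ : 0 < M i k) (h₂ : 0 < N k j) : 0 < (M * N) i j := by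
  rw [mul_apply]
  exact Finset.sum_pos' (fun l _ => mul_nonneg (hM i l) (hN l j))
    ⟨k, Finset.mem_univ k, mul_pos h₁ h₂⟩

theorem Matrix.mul_apply_nonneg_of_nonneg {M N : Matrix ι ι ℝ} (hM : ∀ i j, 0 ≤ M i j)
    (hN : ∀ i j, 0 ≤ N i j) (i j : ι) : 0 ≤ (M * N) i j := by
  rw [mul_apply]
  exact Finset.sum_nonneg fun l _ => mul_nonneg (hM i l) (hN l j)

variable [DecidableEq ι]

theorem Matrix.pow_apply_nonneg_of_nonneg {M : Matrix ι ι ℝ} (hM : ∀ i j, 0 ≤ M i j) (m : ℕ)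
    (i j : ι) : 0 ≤ (M ^ m) i j := by
  induction m generalizing i j with
  | zero => rw [pow_zero, one_apply]; split_ifs <;> norm_num
  | succ m ih => rw [pow_succ]; exact mul_apply_nonneg_of_nonneg ih hM i j

theorem Matrix.reflTransGen_of_pow_apply_pos {M : Matrix ι ι ℝ} (hM : ∀ i j, 0 ≤ M i j) {m : ℕ}
    {i j : ι} (h : 0 < (M ^ m) i j) : Relation.ReflTransGen (fun a b => 0 < M a b) i j := by
  induction m generalizing j with
  | zero =>
    rw [pow_zero, one_apply] at h
    split_ifs at h with hij
    · rw [hij]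
    · exact absurd h (lt_irrefl 0)
  | succ m ih =>
    rw [pow_succ] at h
    obtain ⟨k, hik, hkj⟩ := exists_pos_of_mul_apply_pos (pow_apply_nonneg_of_nonneg hM m) hM h
    exact (ih hik).tail hkj

theorem Matrix.transGen_iff_exists_pow_apply_pos {M : Matrix ι ι ℝ} (hM : ∀ i j, 0 ≤ M i j)
    {i j : ι} :
    Relation.TransGen (fun a b => 0 < M a b) i j ↔ ∃ m, 1 ≤ m ∧ 0 < (M ^ m) i j := by
  constructor
  · intro h
    induction h with
    | single h => exact ⟨1, le_rfl, by rwa [pow_one]⟩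
    | tail _ h ih =>
      obtain ⟨m, -, hm⟩ := ih
      refine ⟨m + 1, Nat.le_add_left 1 m, ?_⟩
      rw [pow_succ]
      exact mul_apply_pos_of_pos (pow_apply_nonneg_of_nonneg hM m) hM hm h
  · rintro ⟨m, hm, h⟩
    obtain ⟨m, rfl⟩ := Nat.exists_eq_add_of_le' hm
    rw [pow_succ] at h
    obtain ⟨k, hik, hkj⟩ := exists_pos_of_mul_apply_pos (pow_apply_nonneg_of_nonneg hM m) hM h
    exact Relation.TransGen.tail' (reflTransGen_of_pow_apply_pos hM hik) hkj

theorem Matrix.eq_of_apply_self_eq_one {M : Matrix ι ι ℝ} (hM : ∀ i j, 0 ≤ M i j)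
    (hrow : ∀ i, ∑ j, M i j = 1) {i j : ι} (hi : M i i = 1) (hij : 0 < M i j) : i = j := by
  by_contra hne
  have h := Finset.add_le_sum (fun k _ => hM i k) (Finset.mem_univ i) (Finset.mem_univ j) hne
  rw [hrow, hi] at h
  linarith

/-- If every row of `B` at a vertex that is not absorbing for `A` supports that row of `A`, and `A`
has odd closed walks everywhere, then edges of `A` are joined by walks of `B * A`. -/
theorem Matrix.reflTransGen_mul_of_apply_pos {A B : Matrix ι ι ℝ} (hA : ∀ i j, 0 ≤ A i j)
    (hB : ∀ i j, 0 ≤ B i j) (hrow : ∀ i, ∑ j, A i j = 1)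
    (hodd : ∀ i, ∃ ℓ, 1 ≤ ℓ ∧ Odd ℓ ∧ 0 < (A ^ ℓ) i i)
    (hAB : ∀ i j, A i i ≠ 1 → 0 < A i j → 0 < B i j) {i j : ι} (hij : 0 < A i j) :
    Relation.ReflTransGen (fun a b => 0 < (B * A) a b) i j := by
  have hsq : ∀ a b, 0 < (A ^ 2) a b → Relation.ReflTransGen (fun a b => 0 < (B * A) a b) a b := by
    intro a b hab
    rw [pow_two] at hab
    obtain ⟨c, hac, hcb⟩ := exists_pos_of_mul_apply_pos hA hA hab
    by_cases ha : A a a = 1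
    · obtain rfl := eq_of_apply_self_eq_one hA hrow ha hac
      obtain rfl := eq_of_apply_self_eq_one hA hrow ha hcb
      exact .refl
    · exact .single (mul_apply_pos_of_pos hB hA (hAB a c ha hac) hcb)
  obtain ⟨ℓ, -, hℓ, hi⟩ := hodd i
  obtain ⟨k, hk⟩ := hℓ.add_one
  have h : 0 < (A ^ (ℓ + 1)) i j := by
    rw [pow_succ]
    exact mul_apply_pos_of_pos (pow_apply_nonneg_of_nonneg hA ℓ) hA hi hij
  rw [hk, ← two_mul, pow_mul] at h
  have hwalk := reflTransGen_of_pow_apply_pos (pow_apply_nonneg_of_nonneg hA 2) h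
  clear hij h
  induction hwalk with
  | refl => exact .refl
  | tail _ hbc ih => exact ih.trans (hsq _ _ hbc)

end Support

/-- In the multiplex construction, the product matrix `C' = B * A₁`
is irreducible. -/
theorem multiplex_product_irreducible (n : ℕ) (hn : 2 ≤ n)
    (A₁ A₂ B : Matrix (Fin n) (Fin n) ℝ)
    -- A₁, A₂ are row-stochastic
    (hA₁nonneg : ∀ i j, 0 ≤ A₁ i j) (hA₁row : ∀ i, ∑ j, A₁ i j = 1)
    (hA₂nonneg : ∀ i j, 0 ≤ A₂ i j) (hA₂row : ∀ i, ∑ j, A₂ i j = 1)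
    -- symmetric support
    (hA₁sym : ∀ i j, 0 < A₁ i j ↔ 0 < A₁ j i)
    (hA₂sym : ∀ i j, 0 < A₂ i j ↔ 0 < A₂ j i)
    -- every strongly connected component of each layer contains an odd closed walk
    (hA₁odd : ∀ i, ∃ ℓ, 1 ≤ ℓ ∧ Odd ℓ ∧ 0 < (A₁ ^ ℓ) i i)
    (hA₂odd : ∀ i, ∃ ℓ, 1 ≤ ℓ ∧ Odd ℓ ∧ 0 < (A₂ ^ ℓ) i i)
    -- the combined-layer matrix B, defined row-wise
    (hB : ∀ i j, B i j =
      if A₂ i i = 1 then A₁ i j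
      else if A₁ i i = 1 then A₂ i j
      else (A₁ i j + A₂ i j) / 2)
    -- B is irreducible
    (hBirr : ∀ i j, ∃ m, 1 ≤ m ∧ 0 < (B ^ m) i j) :
    -- conclusion: B * A₁ is irreducible
    ∀ i j, ∃ m, 1 ≤ m ∧ 0 < ((B * A₁) ^ m) i j := by
  have hBnonneg : ∀ i j, 0 ≤ B i j := by
    intro i j
    have h₁ := hA₁nonneg i j
    have h₂ := hA₂nonneg i j
    rw [hB]
    split_ifs <;> linarith
  have hAB : ∀ i j, A₁ i i ≠ 1 → 0 < A₁ i j → 0 < B i j := by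
    intro i j hi hij
    have h₂ := hA₂nonneg i j
    rw [hB]
    split_ifs <;> linarith
  intro i j
  rw [← transGen_iff_exists_pow_apply_pos (mul_apply_nonneg_of_nonneg hBnonneg hA₁nonneg)]
  have hstep : ∀ a b, 0 < B a b → Relation.TransGen (fun a b => 0 < (B * A₁) a b) a b := by
    intro a b hab
    obtain ⟨c, -, hbc⟩ := Finset.exists_lt_of_sum_lt (s := Finset.univ)
      (f := fun _ : Fin n => (0 : ℝ)) (g := A₁ b) (by simp [hA₁row])
    exact Relation.TransGen.head' (mul_apply_pos_of_pos hBnonneg hA₁nonneg hab hbc)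
      (reflTransGen_mul_of_apply_pos hA₁nonneg hBnonneg hA₁row hA₁odd hAB ((hA₁sym b c).1 hbc))
  have hwalk := (transGen_iff_exists_pow_apply_pos hBnonneg).2 (hBirr i j)
  induction hwalk with
  | single h => exact hstep _ _ h
  | tail _ h ih => exact ih.trans (hstep _ _ h)
end

section
/- Let n ≥ 2 and let A₁, A₂, B be as in the multiplex construction (B is the combined-layer matrix built from the row-stochastic, symmetric-support layer matrices A₁, A₂, with B irreducible and every strongly connected component of each layer containing an odd closed walk). Then for every integer k ≥ 1 the matrix C = B · A₁^{k−1} is SIA: there exists a probability vector π ∈ ℝ^n (π_i ≥ 0 for all i and ∑_i π_i = 1) such that C^m converges, as m → ∞, to the rank-one matrix 𝟙π^T whose (i,j) entry is π_j for all i. -/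
open Matrix

namespace Matrix

variable {ι : Type*} [Fintype ι]

lemma mul_apply_pos_iff {M N : Matrix ι ι ℝ} (hM : ∀ i j, 0 ≤ M i j) (hN : ∀ i j, 0 ≤ N i j)
    {i j : ι} : 0 < (M * N) i j ↔ ∃ l, 0 < M i l ∧ 0 < N l j := by
  rw [mul_apply, Finset.sum_pos_iff_of_nonneg fun l _ => mul_nonneg (hM i l) (hN l j)]
  refine ⟨?_, ?_⟩
  · rintro ⟨l, -, hl⟩
    exact ⟨l, pos_of_mul_pos_left hl (hN l j), pos_of_mul_pos_right hl (hM i l)⟩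
  · rintro ⟨l, h₁, h₂⟩
    exact ⟨l, Finset.mem_univ l, mul_pos h₁ h₂⟩

variable [DecidableEq ι]

lemma pow_add_apply_pos {M : Matrix ι ι ℝ} (hM : ∀ i j, 0 ≤ M i j) {p q : ℕ} {i l j : ι}
    (h₁ : 0 < (M ^ p) i l) (h₂ : 0 < (M ^ q) l j) : 0 < (M ^ (p + q)) i j := by
  rw [pow_add]
  exact (mul_apply_pos_iff (pow_apply_nonneg hM p) (pow_apply_nonneg hM q)).2 ⟨l, h₁, h₂⟩

lemma pow_apply_self_pos {M : Matrix ι ι ℝ} (hM : ∀ i j, 0 ≤ M i j) {i : ι}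
    (h : 0 < M i i) (m : ℕ) : 0 < (M ^ m) i i := by
  induction m with
  | zero => simp
  | succ m ih => exact pow_add_apply_pos hM ih (by rwa [pow_one])

lemma pow_apply_pos_symm {M : Matrix ι ι ℝ} (hM : ∀ i j, 0 ≤ M i j)
    (hsym : ∀ i j, 0 < M i j ↔ 0 < M j i) {m : ℕ} {i j : ι} (h : 0 < (M ^ m) i j) :
    0 < (M ^ m) j i := by
  induction m generalizing i j with
  | zero =>
    obtain rfl : i = j := by
      by_contra hij
      simp [one_apply_ne hij] at h
    exact h
  | succ m ih =>
    rw [pow_succ] at h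
    obtain ⟨l, h₁, h₂⟩ := (mul_apply_pos_iff (pow_apply_nonneg hM m) hM).1 h
    rw [add_comm]
    exact pow_add_apply_pos hM (by rw [pow_one]; exact (hsym _ _).1 h₂) (ih h₁)

/-- Positivity of powers transfers between two nonnegative matrices along a set of indices
closed under the support of the first one. -/
lemma pow_apply_pos_of_support_subset {P Q : Matrix ι ι ℝ} (hP : ∀ i j, 0 ≤ P i j)
    (hQ : ∀ i j, 0 ≤ Q i j) {K : Set ι}
    (hK : ∀ i ∈ K, ∀ j, 0 < P i j → j ∈ K ∧ 0 < Q i j) {m : ℕ} {i j : ι} (hi : i ∈ K)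
    (h : 0 < (P ^ m) i j) : j ∈ K ∧ 0 < (Q ^ m) i j := by
  induction m generalizing j with
  | zero =>
    obtain rfl : i = j := by
      by_contra hij
      simp [one_apply_ne hij] at h
    exact ⟨hi, by simp⟩
  | succ m ih =>
    rw [pow_succ] at h
    obtain ⟨l, h₁, h₂⟩ := (mul_apply_pos_iff (pow_apply_nonneg hP m) hP).1 h
    obtain ⟨hl, hQl⟩ := ih h₁
    obtain ⟨hj, hQj⟩ := hK l hl j h₂
    exact ⟨hj, pow_add_apply_pos hQ hQl (by rwa [pow_one])⟩

lemma exists_apply_pos_of_mem_rowStochastic {M : Matrix ι ι ℝ} (hM : M ∈ rowStochastic ℝ ι)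
    (i : ι) : ∃ j, 0 < M i j := by
  by_contra! h
  have := Finset.sum_nonpos fun j (_ : j ∈ Finset.univ) => h j
  rw [sum_row_of_mem_rowStochastic hM i] at this
  linarith

lemma apply_eq_zero_of_apply_self_eq_one {M : Matrix ι ι ℝ} (hM : M ∈ rowStochastic ℝ ι)
    {i j : ι} (h : M i i = 1) (hij : i ≠ j) : M i j = 0 := by
  have h₁ := sum_row_of_mem_rowStochastic hM i
  rw [← Finset.add_sum_erase _ _ (Finset.mem_univ i), h] at h₁
  exact (Finset.sum_eq_zero_iff_of_nonneg fun l _ => hM.1 i l).1 (by linarith) j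
    (Finset.mem_erase.2 ⟨hij.symm, Finset.mem_univ j⟩)

/-- A row-stochastic matrix with symmetric support has positive `i`-th diagonal entry in all
large powers as soon as there is an odd closed walk through `i`. -/
lemma eventually_pow_apply_self_pos_of_odd {M : Matrix ι ι ℝ} (hM : M ∈ rowStochastic ℝ ι)
    (hsym : ∀ i j, 0 < M i j ↔ 0 < M j i) {i : ι} {l : ℕ} (hl : Odd l) (h : 0 < (M ^ l) i i) :
    ∀ m, l ≤ m → 0 < (M ^ m) i i := by
  obtain ⟨j, hj⟩ := exists_apply_pos_of_mem_rowStochastic hM i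
  have h₂ : 0 < (M ^ 2) i i := by
    rw [pow_two]
    exact (mul_apply_pos_iff hM.1 hM.1).2 ⟨j, hj, (hsym _ _).1 hj⟩
  have heven (q : ℕ) : 0 < (M ^ (2 * q)) i i := by
    rw [pow_mul]
    exact pow_apply_self_pos (pow_apply_nonneg hM.1 2) h₂ q
  intro m hm
  obtain ⟨q, rfl | rfl⟩ := m.even_or_odd'
  · exact heven q
  · obtain ⟨r, rfl⟩ := hl
    have := pow_add_apply_pos hM.1 h (heven (q - r))
    rwa [show 2 * r + 1 + 2 * (q - r) = 2 * q + 1 by lia] at this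

/-- A nonnegative irreducible matrix with an aperiodic state is primitive. -/
lemma exists_pow_pos_of_eventually_pow_apply_self_pos {M : Matrix ι ι ℝ}
    (hM : ∀ i j, 0 ≤ M i j) (hconn : ∀ i j, ∃ p, 0 < (M ^ p) i j) {i₀ : ι} {l : ℕ}
    (h₀ : ∀ m, l ≤ m → 0 < (M ^ m) i₀ i₀) : ∃ N, ∀ i j, 0 < (M ^ N) i j := by
  have h : ∀ i j, ∀ᶠ m in Filter.atTop, 0 < (M ^ m) i j := by
    intro i j
    obtain ⟨p, hp⟩ := hconn i i₀
    obtain ⟨q, hq⟩ := hconn i₀ j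
    filter_upwards [Filter.eventually_ge_atTop (p + l + q)] with m hm
    have := pow_add_apply_pos hM (pow_add_apply_pos hM hp (h₀ (m - p - q) (by lia))) hq
    rwa [show p + (m - p - q) + q = m by lia] at this
  exact (Filter.eventually_all.2 fun i => Filter.eventually_all.2 (h i)).exists

/-- One step of a row-stochastic matrix with entries at least `δ` contracts the oscillation of
a vector by the factor `1 - δ`. -/
lemma mulVec_oscillation_le [Nonempty ι] {P : Matrix ι ι ℝ} (hP : P ∈ rowStochastic ℝ ι) {δ : ℝ}
    (hδ : ∀ i j, δ ≤ P i j) (v : ι → ℝ) :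
    (⨆ i, (P *ᵥ v) i) - (⨅ i, (P *ᵥ v) i) ≤ (1 - δ) * ((⨆ i, v i) - ⨅ i, v i) := by
  obtain ⟨i₁, hi₁⟩ := exists_eq_ciInf_of_finite (f := v)
  have hle (i : ι) : v i ≤ ⨆ i, v i := le_ciSup (Set.finite_range v).bddAbove i
  have hge (i : ι) : (⨅ i, v i) ≤ v i := ciInf_le (Set.finite_range v).bddBelow i
  have hsum (i : ι) (c : ℝ) : ∑ l, P i l * c = c := by
    rw [← Finset.sum_mul, sum_row_of_mem_rowStochastic hP, one_mul]
  set a := ⨅ i, v i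
  set b := ⨆ i, v i
  have hlow : a ≤ ⨅ i, (P *ᵥ v) i := le_ciInf fun i => by
    rw [← hsum i a]
    exact Finset.sum_le_sum fun l _ => mul_le_mul_of_nonneg_left (hge l) (hP.1 i l)
  have hup : (⨆ i, (P *ᵥ v) i) ≤ b - δ * (b - a) := ciSup_le fun i => by
    have h₁ : P i i₁ * (b - v i₁) ≤ ∑ l, P i l * (b - v l) :=
      Finset.single_le_sum (f := fun l => P i l * (b - v l))
        (fun l _ => mul_nonneg (hP.1 i l) (sub_nonneg.2 (hle l))) (Finset.mem_univ i₁)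
    have h₂ : δ * (b - a) ≤ P i i₁ * (b - v i₁) := by
      rw [hi₁]
      exact mul_le_mul_of_nonneg_right (hδ i i₁) (by linarith [hle i₁, hge i₁])
    have h₃ : ∑ l, P i l * (b - v l) = b - (P *ᵥ v) i := by
      simp only [mul_sub, Finset.sum_sub_distrib, hsum, mulVec, dotProduct]
    linarith
  linarith

/-- The iterates of a vector under a row-stochastic matrix with a positive power converge to a
constant vector. -/
lemma exists_tendsto_pow_mulVec [Nonempty ι] {M : Matrix ι ι ℝ} (hM : M ∈ rowStochastic ℝ ι)
    {N : ℕ} (hN : ∀ i j, 0 < (M ^ N) i j) (v : ι → ℝ) :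
    ∃ c, ∀ i, Filter.Tendsto (fun m => (M ^ m *ᵥ v) i) Filter.atTop (nhds c) := by
  have hle (w : ι → ℝ) (i : ι) : w i ≤ ⨆ i, w i := le_ciSup (Set.finite_range w).bddAbove i
  have hge (w : ι → ℝ) (i : ι) : (⨅ i, w i) ≤ w i := ciInf_le (Set.finite_range w).bddBelow i
  have hsum (i : ι) (c : ℝ) : ∑ l, M i l * c = c := by
    rw [← Finset.sum_mul, sum_row_of_mem_rowStochastic hM, one_mul]
  set a : ℕ → ℝ := fun m => ⨅ i, (M ^ m *ᵥ v) i with ha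
  set b : ℕ → ℝ := fun m => ⨆ i, (M ^ m *ᵥ v) i with hb
  have hab (m : ℕ) : a m ≤ b m :=
    (hge (M ^ m *ᵥ v) (Classical.arbitrary ι)).trans (hle (M ^ m *ᵥ v) _)
  have hmono : Monotone a := monotone_nat_of_le_succ fun m => le_ciInf fun i => by
    rw [pow_succ', ← mulVec_mulVec, ← hsum i (a m)]
    exact Finset.sum_le_sum fun l _ => mul_le_mul_of_nonneg_left (hge _ l) (hM.1 i l)
  have hanti : Antitone b := antitone_nat_of_succ_le fun m => ciSup_le fun i => by
    rw [pow_succ', ← mulVec_mulVec, ← hsum i (b m)]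
    exact Finset.sum_le_sum fun l _ => mul_le_mul_of_nonneg_left (hle _ l) (hM.1 i l)
  have hta := tendsto_atTop_ciSup hmono
    ⟨b 0, Set.forall_mem_range.2 fun m => (hab m).trans (hanti m.zero_le)⟩
  have htb := tendsto_atTop_ciInf hanti
    ⟨a 0, Set.forall_mem_range.2 fun m => (hmono m.zero_le).trans (hab m)⟩
  set α := ⨆ m, a m
  set β := ⨅ m, b m
  obtain ⟨p, hp⟩ := exists_eq_ciInf_of_finite (f := fun p : ι × ι => (M ^ N) p.1 p.2)
  set δ := (M ^ N) p.1 p.2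
  have hδ : ∀ i j, δ ≤ (M ^ N) i j := fun i j => by
    rw [hp]
    exact ciInf_le (Set.finite_range fun p : ι × ι => (M ^ N) p.1 p.2).bddBelow (i, j)
  have hcontr (m : ℕ) : b (m + N) - a (m + N) ≤ (1 - δ) * (b m - a m) := by
    have := mulVec_oscillation_le (pow_mem hM N) hδ (M ^ m *ᵥ v)
    rwa [mulVec_mulVec, ← pow_add, add_comm N m] at this
  have hlim : β - α ≤ (1 - δ) * (β - α) :=
    le_of_tendsto_of_tendsto'
      (((Filter.tendsto_add_atTop_iff_nat N).2 htb).sub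
        ((Filter.tendsto_add_atTop_iff_nat N).2 hta))
      ((htb.sub hta).const_mul (1 - δ)) hcontr
  have hαβ : α ≤ β := le_of_tendsto_of_tendsto' hta htb hab
  have heq : β = α := by
    have hpos : 0 < δ := hN _ _
    nlinarith
  rw [heq] at htb
  exact ⟨α, fun i => tendsto_of_tendsto_of_tendsto_of_le_of_le hta htb
    (fun m => hge (M ^ m *ᵥ v) i) (fun m => hle (M ^ m *ᵥ v) i)⟩

/-- The powers of a row-stochastic matrix having a positive power converge to a rank-one
row-stochastic matrix. -/
lemma exists_tendsto_pow_of_mem_rowStochastic [Nonempty ι] {M : Matrix ι ι ℝ}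
    (hM : M ∈ rowStochastic ℝ ι) {N : ℕ} (hN : ∀ i j, 0 < (M ^ N) i j) :
    ∃ π : ι → ℝ, (∀ i, 0 ≤ π i) ∧ (∑ i, π i = 1) ∧
      Filter.Tendsto (fun m => M ^ m) Filter.atTop (nhds (Matrix.of fun _ j => π j)) := by
  choose π hπ using fun j => exists_tendsto_pow_mulVec hM hN (Pi.single j 1)
  simp only [mulVec_single_one, col_apply] at hπ
  have i₀ := Classical.arbitrary ι
  refine ⟨π, fun j => ge_of_tendsto' (hπ j i₀) fun m => pow_apply_nonneg hM.1 m i₀ j, ?_, ?_⟩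
  · refine tendsto_nhds_unique (tendsto_finsetSum Finset.univ fun j _ => hπ j i₀) ?_
    simp only [sum_row_of_mem_rowStochastic (pow_mem hM _), tendsto_const_nhds]
  · exact tendsto_pi_nhds.2 fun i => tendsto_pi_nhds.2 fun j => hπ j i

end Matrix

/-- In the multiplex construction, for every integer k ≥ 1 the matrix
`C = B * A₁ ^ (k - 1)` is SIA: its powers converge to a rank-one matrix `𝟙 πᵀ`
for some probability vector π. -/
theorem multiplex_C_SIA (n : ℕ) (hn : 2 ≤ n)
    (A₁ A₂ B : Matrix (Fin n) (Fin n) ℝ)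
    -- A₁, A₂ are row-stochastic
    (hA₁nonneg : ∀ i j, 0 ≤ A₁ i j) (hA₁row : ∀ i, ∑ j, A₁ i j = 1)
    (hA₂nonneg : ∀ i j, 0 ≤ A₂ i j) (hA₂row : ∀ i, ∑ j, A₂ i j = 1)
    -- symmetric support
    (hA₁sym : ∀ i j, 0 < A₁ i j ↔ 0 < A₁ j i)
    (hA₂sym : ∀ i j, 0 < A₂ i j ↔ 0 < A₂ j i)
    -- every strongly connected component of each layer contains an odd closed walk
    (hA₁odd : ∀ i, ∃ ℓ, 1 ≤ ℓ ∧ Odd ℓ ∧ 0 < (A₁ ^ ℓ) i i)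
    (hA₂odd : ∀ i, ∃ ℓ, 1 ≤ ℓ ∧ Odd ℓ ∧ 0 < (A₂ ^ ℓ) i i)
    -- the combined-layer matrix B, defined row-wise
    (hB : ∀ i j, B i j =
      if A₂ i i = 1 then A₁ i j
      else if A₁ i i = 1 then A₂ i j
      else (A₁ i j + A₂ i j) / 2)
    -- B is irreducible
    (hBirr : ∀ i j, ∃ m, 1 ≤ m ∧ 0 < (B ^ m) i j) :
    -- conclusion: for every k ≥ 1, B * A₁ ^ (k - 1) is SIA
    ∀ k : ℕ, 1 ≤ k → ∃ π : Fin n → ℝ, (∀ i, 0 ≤ π i) ∧ (∑ i, π i = 1) ∧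
      Filter.Tendsto (fun m => (B * A₁ ^ (k - 1)) ^ m) Filter.atTop
        (nhds (Matrix.of fun _ j => π j)) := by
  have hA₁ : A₁ ∈ rowStochastic ℝ (Fin n) := mem_rowStochastic_iff_sum.2 ⟨hA₁nonneg, hA₁row⟩
  have hA₂ : A₂ ∈ rowStochastic ℝ (Fin n) := mem_rowStochastic_iff_sum.2 ⟨hA₂nonneg, hA₂row⟩
  have hBS : B ∈ rowStochastic ℝ (Fin n) := by
    refine mem_rowStochastic_iff_sum.2 ⟨fun i j => ?_, fun i => ?_⟩
    · have := hA₁nonneg i j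
      have := hA₂nonneg i j
      rw [hB]
      split_ifs <;> linarith
    · simp only [hB]
      split_ifs
      · exact hA₁row i
      · exact hA₂row i
      · rw [← Finset.sum_div, Finset.sum_add_distrib, hA₁row, hA₂row]
        norm_num
  have : Nonempty (Fin n) := ⟨⟨0, by lia⟩⟩
  intro k hk
  obtain ⟨r, rfl⟩ : ∃ r, k = r + 1 := ⟨k - 1, by lia⟩
  rw [Nat.add_sub_cancel]
  set C := B * A₁ ^ r with hC
  have hCS : C ∈ rowStochastic ℝ (Fin n) := mul_mem hBS (pow_mem hA₁ r)
  have hA₁r := pow_apply_nonneg hA₁nonneg r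
  set K : Set (Fin n) := {i | A₁ i i ≠ 1} with hK
  have hBpos {i j : Fin n} (hi : i ∈ K) (h : 0 < A₁ i j) : 0 < B i j := by
    have := hA₂nonneg i j
    rw [hB, if_neg (show ¬ A₁ i i = 1 from hi)]
    split_ifs <;> linarith
  have hKclosed : ∀ i ∈ K, ∀ j, 0 < A₁ i j → j ∈ K ∧ 0 < A₁ i j := by
    refine fun i hi j h => ⟨fun hj => ?_, h⟩
    obtain rfl | hij := eq_or_ne j i
    · exact hi hj
    · exact ((hA₁sym i j).1 h).ne' (apply_eq_zero_of_apply_self_eq_one hA₁ hj hij)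
  have hKpow {m : ℕ} {i j : Fin n} (hi : i ∈ K) (h : 0 < (A₁ ^ m) i j) : j ∈ K :=
    (pow_apply_pos_of_support_subset hA₁nonneg hA₁nonneg hKclosed hi h).1
  have hCpow {m : ℕ} {i j : Fin n} (hi : i ∈ K) (h : 0 < (A₁ ^ ((r + 1) * m)) i j) :
      0 < (C ^ m) i j := by
    rw [pow_mul] at h
    refine (pow_apply_pos_of_support_subset (pow_apply_nonneg hA₁nonneg (r + 1)) hCS.1
      (K := K) (fun i hi j h => ⟨hKpow hi h, ?_⟩) hi h).2
    rw [pow_succ'] at h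
    obtain ⟨l, h₁, h₂⟩ := (mul_apply_pos_iff hA₁nonneg hA₁r).1 h
    exact (mul_apply_pos_iff hBS.1 hA₁r).2 ⟨l, hBpos hi h₁, h₂⟩
  have hloop (i : Fin n) : ∃ l, ∀ m, l ≤ m → 0 < (A₁ ^ m) i i := by
    obtain ⟨l, -, hl, h⟩ := hA₁odd i
    exact ⟨l, eventually_pow_apply_self_pos_of_odd hA₁ hA₁sym hl h⟩
  have hstep {i j : Fin n} (h : 0 < B i j) : ∃ p, 0 < (C ^ p) i j := by
    obtain ⟨j', hj'⟩ := exists_apply_pos_of_mem_rowStochastic (pow_mem hA₁ r) j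
    by_cases hj : j ∈ K
    · obtain ⟨l, hl⟩ := hloop j
      have h₁ : 0 < (C ^ 1) i j' := by
        rw [pow_one]
        exact (mul_apply_pos_iff hBS.1 hA₁r).2 ⟨j, h, hj'⟩
      have h₂ : 0 < (A₁ ^ ((r + 1) * (l + r))) j' j := by
        have := pow_add_apply_pos hA₁nonneg (pow_apply_pos_symm hA₁nonneg hA₁sym hj')
          (hl ((r + 1) * (l + r) - r) (by apply Nat.le_sub_of_add_le; nlinarith))
        rwa [Nat.add_sub_cancel' (by nlinarith)] at this
      exact ⟨_, pow_add_apply_pos hCS.1 h₁ (hCpow (hKpow hj hj') h₂)⟩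
    · have hjj : A₁ j j = 1 := not_not.1 hj
      refine ⟨1, ?_⟩
      rw [pow_one]
      exact (mul_apply_pos_iff hBS.1 hA₁r).2
        ⟨j, h, pow_apply_self_pos hA₁nonneg (by rw [hjj]; exact one_pos) r⟩
  have hconn (i j : Fin n) : ∃ p, 0 < (C ^ p) i j := by
    obtain ⟨m, -, hm⟩ := hBirr i j
    induction m generalizing j with
    | zero => exact ⟨0, hm⟩
    | succ m ih =>
      rw [pow_succ] at hm
      obtain ⟨l, h₁, h₂⟩ := (mul_apply_pos_iff (pow_apply_nonneg hBS.1 m) hBS.1).1 hm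
      obtain ⟨p, hp⟩ := ih l h₁
      obtain ⟨q, hq⟩ := hstep h₂
      exact ⟨_, pow_add_apply_pos hCS.1 hp hq⟩
  have haper : ∃ i l, ∀ m, l ≤ m → 0 < (C ^ m) i i := by
    by_cases hne : K.Nonempty
    · obtain ⟨i, hi⟩ := hne
      obtain ⟨l, hl⟩ := hloop i
      exact ⟨i, l, fun m hm => hCpow hi (hl _ (by nlinarith))⟩
    · have hdiag (i : Fin n) : A₁ i i = 1 := by
        by_contra hi
        exact hne ⟨i, hi⟩
      have hone {M : Matrix (Fin n) (Fin n) ℝ} (hM : M ∈ rowStochastic ℝ (Fin n))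
          {i : Fin n} (h : M i i = 1) (j : Fin n) : M i j = (1 : Matrix (Fin n) (Fin n) ℝ) i j := by
        obtain rfl | hij := eq_or_ne i j
        · rw [h, one_apply_eq]
        · rw [apply_eq_zero_of_apply_self_eq_one hM h hij, one_apply_ne hij]
      have hA₁one : A₁ = 1 := ext fun i j => hone hA₁ (hdiag i) j
      have hCA₂ : C = A₂ := by
        rw [hC, hA₁one, one_pow, mul_one]
        ext i j
        rw [hB, if_pos (hdiag i)]
        split_ifs with h
        · rw [hone hA₂ h, hA₁one]
        · rfl
      obtain ⟨i⟩ := this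
      obtain ⟨l, -, hl, h⟩ := hA₂odd i
      rw [hCA₂]
      exact ⟨i, l, eventually_pow_apply_self_pos_of_odd hA₂ hA₂sym hl h⟩
  obtain ⟨i, l, h⟩ := haper
  obtain ⟨N, hN⟩ := exists_pow_pos_of_eventually_pow_apply_self_pos hCS.1 hconn h
  exact exists_tendsto_pow_of_mem_rowStochastic hCS hN
end

section
/- Let n ≥ 1, let k ≥ 1 be an integer, let A₁ and C be n×n row-stochastic real matrices, and let π be a probability vector such that C^m converges entrywise to 𝟙π^T as m → ∞. Then for every initial opinion vector x₀ ∈ ℝ^n, the sequence x(t) = A₁^{t mod k} · C^{⌊t/k⌋} · x₀ converges as t → ∞, and its limit is the consensus vector (π^T x₀) · 𝟙, i.e., every coordinate of the limit equals ∑_j π_j (x₀)_j. -/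
open Matrix Filter

theorem Filter.Tendsto.mod_div_atTop {α : Type*} {l : Filter α} {k : ℕ} (hk : k ≠ 0)
    {f : ℕ → ℕ → α} (hf : ∀ r < k, Tendsto (f r) atTop l) :
    Tendsto (fun t => f (t % k) (t / k)) atTop l := by
  refine tendsto_def.2 fun s hs => ?_
  have h : ∀ᶠ m in atTop, ∀ r ∈ Finset.range k, f r m ∈ s :=
    (Filter.eventually_all_finset _).2 fun r hr => hf r (Finset.mem_range.1 hr) hs
  filter_upwards [(Nat.tendsto_div_const_atTop hk).eventually h] with t ht
  exact ht _ (Finset.mem_range.2 (Nat.mod_lt _ (Nat.pos_of_ne_zero hk)))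

theorem Matrix.pow_mulVec_eq_self {ι R : Type*} [Fintype ι] [DecidableEq ι] [Semiring R]
    {A : Matrix ι ι R} {v : ι → R} (h : A.mulVec v = v) (r : ℕ) : (A ^ r).mulVec v = v := by
  induction r with
  | zero => simp
  | succ r ih => rw [pow_succ, ← Matrix.mulVec_mulVec, h, ih]

/-- If `C ^ m → 𝟙 πᵀ`, then the opinion dynamics
`x t = A₁ ^ (t % k) * C ^ (t / k) * x₀` converges to the consensus vector `(πᵀ x₀) 𝟙`. -/
theorem switching_opinion_dynamics_converge (n : ℕ) (hn : 1 ≤ n)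
    (k : ℕ) (hk : 1 ≤ k)
    (A₁ C : Matrix (Fin n) (Fin n) ℝ)
    -- A₁, C are row-stochastic
    (hA₁nonneg : ∀ i j, 0 ≤ A₁ i j) (hA₁row : ∀ i, ∑ j, A₁ i j = 1)
    (hCnonneg : ∀ i j, 0 ≤ C i j) (hCrow : ∀ i, ∑ j, C i j = 1)
    -- π is a probability vector and C ^ m → 𝟙 πᵀ entrywise
    (π : Fin n → ℝ) (hπnonneg : ∀ i, 0 ≤ π i) (hπsum : ∑ i, π i = 1)
    (hC : Tendsto (fun m => C ^ m) atTop (nhds (Matrix.of fun _ j => π j))) :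
    ∀ x₀ : Fin n → ℝ,
      Tendsto (fun t => (A₁ ^ (t % k) * C ^ (t / k)).mulVec x₀) atTop
        (nhds (fun _ => ∑ j, π j * x₀ j)) := by
  intro x₀
  have hA : A₁.mulVec (fun _ => ∑ j, π j * x₀ j) = fun _ => ∑ j, π j * x₀ j := by
    ext i
    simp only [Matrix.mulVec, dotProduct]
    rw [← Finset.sum_mul, hA₁row, one_mul]
  refine Filter.Tendsto.mod_div_atTop (f := fun r m => (A₁ ^ r * C ^ m).mulVec x₀)
    (Nat.one_le_iff_ne_zero.1 hk) fun r _ => ?_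
  have hcont : Continuous fun M : Matrix (Fin n) (Fin n) ℝ => (A₁ ^ r).mulVec (M.mulVec x₀) := by
    fun_prop
  have hlim := (hcont.tendsto _).comp hC
  rw [show (Matrix.of fun _ j => π j).mulVec x₀ = fun _ : Fin n => ∑ j, π j * x₀ j from rfl,
    Matrix.pow_mulVec_eq_self hA r] at hlim
  simpa only [Function.comp_def, Matrix.mulVec_mulVec] using hlim
end

section
/- Let n ≥ 1 and k ≥ 1. Let A₁ be an n×n row-stochastic, primitive real matrix and let μ be a probability vector with μ^T A₁ = μ^T. Let B be an n×n row-stochastic matrix that also satisfies μ^T B = μ^T, set C = B · A₁^{k−1}, and assume C is primitive. Then the accumulated update matrices of the switching dynamics converge to the same limit as the powers of A₁ alone: A₁^{t mod k} · C^{⌊t/k⌋} converges entrywise, as t → ∞, to 𝟙μ^T, which also equals lim_{t→∞} A₁^t. -/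
open Matrix Filter

section StochasticLimits

open scoped Matrix.Norms.Operator Topology

variable {ι : Type*} [Fintype ι]

/-- A nonnegative matrix whose rows sum to `c` has `ℓ^∞` operator norm at most `c`. -/
lemma linfty_opNorm_le_of_nonneg_of_sum_row {M : Matrix ι ι ℝ} {c : ℝ} (hc : 0 ≤ c)
    (hM : ∀ i j, 0 ≤ M i j) (hsum : ∀ i, ∑ j, M i j = c) : ‖M‖ ≤ c := by
  lift c to NNReal using hc
  rw [linfty_opNorm_def, NNReal.coe_le_coe]
  refine Finset.sup_le fun i _ => ?_
  rw [← NNReal.coe_le_coe, ← hsum i]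
  push_cast
  exact (Finset.sum_congr rfl fun j _ => by simp [abs_of_nonneg (hM i j)]).le

variable [DecidableEq ι]

lemma linfty_opNorm_le_one_of_mem_rowStochastic {M : Matrix ι ι ℝ} (hM : M ∈ rowStochastic ℝ ι) :
    ‖M‖ ≤ 1 :=
  linfty_opNorm_le_of_nonneg_of_sum_row zero_le_one (fun _ _ => nonneg_of_mem_rowStochastic hM)
    (sum_row_of_mem_rowStochastic hM)

lemma mul_vecMulVec_one_of_mem_rowStochastic {M : Matrix ι ι ℝ} (hM : M ∈ rowStochastic ℝ ι)
    (μ : ι → ℝ) : M * vecMulVec 1 μ = vecMulVec 1 μ := by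
  rw [mul_vecMulVec, one_vecMul_of_mem_rowStochastic hM]

lemma vecMul_pow_of_vecMul_eq {M : Matrix ι ι ℝ} {μ : ι → ℝ} (h : μ ᵥ* M = μ) (m : ℕ) :
    μ ᵥ* M ^ m = μ := by
  induction m with
  | zero => simp
  | succ m ih => rw [pow_succ, ← vecMul_vecMul, ih, h]

/-- The powers of an entrywise positive row-stochastic matrix converge to the rank-one matrix
of its stationary probability vector. -/
lemma tendsto_pow_of_pos_of_mem_rowStochastic [Nonempty ι] {E : Matrix ι ι ℝ}
    (hE : E ∈ rowStochastic ℝ ι) (hpos : ∀ i j, 0 < E i j) {μ : ι → ℝ} (hμ : ∀ i, 0 ≤ μ i)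
    (hμsum : ∑ i, μ i = 1) (hμE : μ ᵥ* E = μ) :
    Tendsto (fun t => E ^ t) atTop (𝓝 (vecMulVec 1 μ)) := by
  set P : Matrix ι ι ℝ := vecMulVec 1 μ with hP
  obtain ⟨⟨a, b⟩, hab⟩ := Finite.exists_min fun p : ι × ι => E p.1 p.2
  set δ := E a b
  set R := E - δ • P with hR
  have hδ : 0 < δ := hpos a b
  have hδ1 : δ ≤ 1 := le_one_of_mem_rowStochastic hE
  have hμ1 (j : ι) : μ j ≤ 1 :=
    hμsum ▸ Finset.single_le_sum (fun i _ => hμ i) (Finset.mem_univ j)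
  have hRnorm : ‖R‖ ≤ 1 - δ := by
    refine linfty_opNorm_le_of_nonneg_of_sum_row (by linarith) (fun i j => ?_) fun i => ?_
    · have h₁ : δ * μ j ≤ δ := mul_le_of_le_one_right hδ.le (hμ1 j)
      have h₂ : δ ≤ E i j := hab (i, j)
      simp only [hR, hP, Matrix.sub_apply, Matrix.smul_apply, vecMulVec_apply, Pi.one_apply,
        one_mul, smul_eq_mul]
      linarith
    · simp [hR, hP, Finset.sum_sub_distrib, ← Finset.mul_sum, hμsum,
        sum_row_of_mem_rowStochastic hE i]
  have hEP (t : ℕ) : E ^ t * P = P :=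
    mul_vecMulVec_one_of_mem_rowStochastic (pow_mem hE t) μ
  have hPE : P * E = P := by rw [hP, vecMulVec_mul, hμE]
  have hPP : P * P = P := by
    rw [hP, vecMulVec_mul_vecMulVec]
    simp [dotProduct, hμsum]
  have hcomm : E * (1 - P) = (1 - P) * E := by
    rw [mul_sub, sub_mul, hPE, ← pow_one E, hEP, mul_one, one_mul]
  have hER : E * (1 - P) = R * (1 - P) := by
    simp [hR, sub_mul, mul_sub, hPP]
  have hpow (t : ℕ) : E ^ t * (1 - P) = R ^ t * (1 - P) := by
    induction t with
    | zero => simp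
    | succ t ih =>
      rw [pow_succ, mul_assoc, hcomm, ← mul_assoc, ih, mul_assoc, ← hcomm, hER, ← mul_assoc,
        ← pow_succ]
  have hdiff (t : ℕ) : E ^ t - P = R ^ t * (1 - P) := by
    rw [← hpow, mul_sub, mul_one, hEP]
  have hRlim : Tendsto (fun t => R ^ t) atTop (𝓝 0) :=
    tendsto_pow_atTop_nhds_zero_of_norm_lt_one (by linarith)
  rw [← tendsto_sub_nhds_zero_iff]
  simpa only [hdiff, zero_mul] using hRlim.mul_const (1 - P)

/-- If the powers of `C` converge to a rank-one matrix `𝟙 μᵀ`, so do their products with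
remainder powers of a row-stochastic matrix. -/
lemma tendsto_pow_mod_mul_pow_div {A C : Matrix ι ι ℝ} (hA : A ∈ rowStochastic ℝ ι) {μ : ι → ℝ}
    (hC : Tendsto (fun t => C ^ t) atTop (𝓝 (vecMulVec 1 μ))) {k : ℕ} (hk : k ≠ 0) :
    Tendsto (fun t => A ^ (t % k) * C ^ (t / k)) atTop (𝓝 (vecMulVec 1 μ)) := by
  have hdiv := (tendsto_sub_nhds_zero_iff.mpr hC).norm.comp (Nat.tendsto_div_const_atTop hk)
  rw [norm_zero] at hdiv
  rw [← tendsto_sub_nhds_zero_iff]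
  refine squeeze_zero_norm (fun t => ?_) hdiv
  have hAt := pow_mem hA (t % k)
  nth_rw 1 [← mul_vecMulVec_one_of_mem_rowStochastic hAt μ]
  rw [← mul_sub]
  exact (norm_mul_le _ _).trans <| mul_le_of_le_one_left (norm_nonneg _)
    (linfty_opNorm_le_one_of_mem_rowStochastic hAt)

/-- The powers of a primitive row-stochastic matrix converge to the rank-one matrix of its
stationary probability vector. -/
lemma tendsto_pow_of_primitive_of_mem_rowStochastic [Nonempty ι] {A : Matrix ι ι ℝ}
    (hA : A ∈ rowStochastic ℝ ι) (hprim : ∃ m, 1 ≤ m ∧ ∀ i j, 0 < (A ^ m) i j) {μ : ι → ℝ}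
    (hμ : ∀ i, 0 ≤ μ i) (hμsum : ∑ i, μ i = 1) (hμA : μ ᵥ* A = μ) :
    Tendsto (fun t => A ^ t) atTop (𝓝 (vecMulVec 1 μ)) := by
  obtain ⟨m, hm, hpos⟩ := hprim
  have h := tendsto_pow_mod_mul_pow_div hA (tendsto_pow_of_pos_of_mem_rowStochastic
    (pow_mem hA m) hpos hμ hμsum (vecMul_pow_of_vecMul_eq hμA m)) (Nat.one_le_iff_ne_zero.mp hm)
  simpa only [← pow_mul, ← pow_add, Nat.mod_add_div] using h

end StochasticLimits

/-- If A₁ is row-stochastic and primitive with stationary probability vector μ,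
B is row-stochastic with the same stationary vector, and `C = B * A₁ ^ (k-1)` is primitive,
then the accumulated update matrices `A₁ ^ (t % k) * C ^ (t / k)` converge entrywise to
`𝟙 μᵀ`, which is also the limit of `A₁ ^ t`. -/
theorem switching_limit_equals_single_layer_limit (n : ℕ) (hn : 1 ≤ n)
    (k : ℕ) (hk : 1 ≤ k)
    (A₁ B : Matrix (Fin n) (Fin n) ℝ)
    -- A₁ is row-stochastic and primitive
    (hA₁nonneg : ∀ i j, 0 ≤ A₁ i j) (hA₁row : ∀ i, ∑ j, A₁ i j = 1)
    (hA₁prim : ∃ m, 1 ≤ m ∧ ∀ i j, 0 < (A₁ ^ m) i j)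
    -- μ is a probability vector, stationary for A₁ and for B
    (μ : Fin n → ℝ) (hμnonneg : ∀ i, 0 ≤ μ i) (hμsum : ∑ i, μ i = 1)
    (hμA₁ : ∀ j, ∑ i, μ i * A₁ i j = μ j)
    -- B is row-stochastic with μᵀ B = μᵀ
    (hBnonneg : ∀ i j, 0 ≤ B i j) (hBrow : ∀ i, ∑ j, B i j = 1)
    (hμB : ∀ j, ∑ i, μ i * B i j = μ j)
    -- C = B * A₁ ^ (k - 1) is primitive
    (C : Matrix (Fin n) (Fin n) ℝ) (hC : C = B * A₁ ^ (k - 1))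
    (hCprim : ∃ m, 1 ≤ m ∧ ∀ i j, 0 < (C ^ m) i j) :
    Tendsto (fun t => A₁ ^ (t % k) * C ^ (t / k)) atTop
        (nhds (Matrix.of fun _ j => μ j)) ∧
      Tendsto (fun t => A₁ ^ t) atTop (nhds (Matrix.of fun _ j => μ j)) := by
  have : Nonempty (Fin n) := ⟨⟨0, hn⟩⟩
  have hP : (Matrix.of fun _ j => μ j : Matrix (Fin n) (Fin n) ℝ) = vecMulVec 1 μ := by
    ext i j
    simp [vecMulVec_apply]
  have hA : A₁ ∈ rowStochastic ℝ (Fin n) := mem_rowStochastic_iff_sum.mpr ⟨hA₁nonneg, hA₁row⟩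
  have hB : B ∈ rowStochastic ℝ (Fin n) := mem_rowStochastic_iff_sum.mpr ⟨hBnonneg, hBrow⟩
  have hμA : μ ᵥ* A₁ = μ := funext hμA₁
  have hμC : μ ᵥ* C = μ := by
    rw [hC, ← vecMul_vecMul, show μ ᵥ* B = μ from funext hμB, vecMul_pow_of_vecMul_eq hμA]
  have hCmem : C ∈ rowStochastic ℝ (Fin n) := hC ▸ mul_mem hB (pow_mem hA _)
  rw [hP]
  exact ⟨tendsto_pow_mod_mul_pow_div hA (tendsto_pow_of_primitive_of_mem_rowStochastic hCmem
      hCprim hμnonneg hμsum hμC) (Nat.one_le_iff_ne_zero.mp hk),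
    tendsto_pow_of_primitive_of_mem_rowStochastic hA hA₁prim hμnonneg hμsum hμA⟩
end
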